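/- Let S⁰ be an adequate semigroup with semilattice of idempotents E⁰, L a left adequate semigroup and R a right adequate semigroup such that S⁰ is a quasi-ideal adequate transversal of both L and R, and let ∗ : R × L → S⁰ satisfy conditions (1) and (2). If a, b ∈ R and y, z ∈ L satisfy ȳ = b̄, then e_{a∗y} = e_{(a∗y)f_b} and f_{e_y(b∗z)} = f_{b∗z}. -/

import Mathlib

/-!
Common framework: "relative" semigroup-theoretic notions.  All notions are taken
relative to a carrier set `U` inside an ambient type, together with an explicit
binary operation `mul` (only the values of `mul` on `U` are relevant).  For an
honest semigroup `S` one takes `U = Set.univ` and `mul = mulOf S`.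

* `RStarOn mul U a b` : the relation `a ℛ* b` computed in `U` with an identity
  adjoined (the two clauses correspond to multipliers from `U` and to the
  adjoined identity).
* `LStarOn`, `GreenLOn`, `GreenROn` : dual / Green's relations.
* `AbundantOn`, `AdequateOn`, `LeftAdequateOn`, `RightAdequateOn`.
* `AdequateTransversalOn mul U S0` : `S0` is an adequate `*`-subsemigroup of `U`
  which is an adequate transversal, with the data `bar x = x̄`, `e x = e_x`,
  `f x = f_x`, and `plus s = s⁺`, `star s = s⋆` for `s ∈ S0`.
* `InverseTransversalOn mul U S0` : `S0` is an inverse transversal of the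
  regular semigroup `U`, with `o x = x⁰` the unique inverse of `x` in `S0`.
-/

namespace Paper

universe u

variable {α : Type*} {β : Type*} {γ : Type*}

def mulOf (α : Type*) [Mul α] : α → α → α := fun a b => a * b

/-- `x` is an idempotent for the operation `mul`. -/
def Idem (mul : α → α → α) (x : α) : Prop := mul x x = x

/-- The relation `ℛ*` on `U` (with an identity adjoined to `U`). -/
def RStarOn (mul : α → α → α) (U : Set α) (a b : α) : Prop :=
  (∀ x ∈ U, ∀ y ∈ U, (mul x a = mul y a ↔ mul x b = mul y b)) ∧
  (∀ x ∈ U, (mul x a = a ↔ mul x b = b))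

/-- The relation `ℒ*` on `U` (with an identity adjoined to `U`). -/
def LStarOn (mul : α → α → α) (U : Set α) (a b : α) : Prop :=
  (∀ x ∈ U, ∀ y ∈ U, (mul a x = mul a y ↔ mul b x = mul b y)) ∧
  (∀ x ∈ U, (mul a x = a ↔ mul b x = b))

/-- Green's relation `ℒ` on `U`: `U¹ a = U¹ b`. -/
def GreenLOn (mul : α → α → α) (U : Set α) (a b : α) : Prop :=
  (a = b ∨ ∃ u ∈ U, mul u b = a) ∧ (b = a ∨ ∃ v ∈ U, mul v a = b)

/-- Green's relation `ℛ` on `U`: `a U¹ = b U¹`. -/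
def GreenROn (mul : α → α → α) (U : Set α) (a b : α) : Prop :=
  (a = b ∨ ∃ u ∈ U, mul b u = a) ∧ (b = a ∨ ∃ v ∈ U, mul a v = b)

/-- `U` is closed under `mul`. -/
def ClosedOn (mul : α → α → α) (U : Set α) : Prop :=
  ∀ a ∈ U, ∀ b ∈ U, mul a b ∈ U

/-- `U` with the operation `mul` is a semigroup. -/
def SemigroupOn (mul : α → α → α) (U : Set α) : Prop :=
  ClosedOn mul U ∧ ∀ a ∈ U, ∀ b ∈ U, ∀ c ∈ U, mul (mul a b) c = mul a (mul b c)

/-- Every `ℛ*`-class and every `ℒ*`-class of `U` contains an idempotent. -/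
def AbundantOn (mul : α → α → α) (U : Set α) : Prop :=
  ∀ a ∈ U, (∃ e ∈ U, Idem mul e ∧ RStarOn mul U a e) ∧
           (∃ f ∈ U, Idem mul f ∧ LStarOn mul U a f)

/-- Abundant with commuting idempotents. -/
def AdequateOn (mul : α → α → α) (U : Set α) : Prop :=
  AbundantOn mul U ∧
    ∀ u ∈ U, ∀ v ∈ U, Idem mul u → Idem mul v → mul u v = mul v u

/-- Abundant, and every `ℛ*`-class contains a unique idempotent. -/
def LeftAdequateOn (mul : α → α → α) (U : Set α) : Prop :=
  AbundantOn mul U ∧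
    ∀ u ∈ U, ∀ v ∈ U, Idem mul u → Idem mul v → RStarOn mul U u v → u = v

/-- Abundant, and every `ℒ*`-class contains a unique idempotent. -/
def RightAdequateOn (mul : α → α → α) (U : Set α) : Prop :=
  AbundantOn mul U ∧
    ∀ u ∈ U, ∀ v ∈ U, Idem mul u → Idem mul v → LStarOn mul U u v → u = v

/-- `S0` is a quasi-ideal of `U` : `S0 U S0 ⊆ S0`. -/
def QuasiIdealOn (mul : α → α → α) (U S0 : Set α) : Prop :=
  ∀ s ∈ S0, ∀ x ∈ U, ∀ t ∈ S0, mul (mul s x) t ∈ S0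

/-- Every element of `U` has an inverse in `U`. -/
def RegularOn (mul : α → α → α) (U : Set α) : Prop :=
  ∀ x ∈ U, ∃ u ∈ U, mul (mul x u) x = x ∧ mul (mul u x) u = u

/-- Regular with commuting idempotents, i.e. an inverse semigroup. -/
def InverseSgpOn (mul : α → α → α) (U : Set α) : Prop :=
  RegularOn mul U ∧
    ∀ u ∈ U, ∀ v ∈ U, Idem mul u → Idem mul v → mul u v = mul v u

/-- Regular, and every Green `ℛ`-class contains a unique idempotent. -/
def LeftInverseSgpOn (mul : α → α → α) (U : Set α) : Prop :=
  RegularOn mul U ∧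
    ∀ u ∈ U, ∀ v ∈ U, Idem mul u → Idem mul v → GreenROn mul U u v → u = v

/-- Regular, and every Green `ℒ`-class contains a unique idempotent. -/
def RightInverseSgpOn (mul : α → α → α) (U : Set α) : Prop :=
  RegularOn mul U ∧
    ∀ u ∈ U, ∀ v ∈ U, Idem mul u → Idem mul v → GreenLOn mul U u v → u = v

/-- An isomorphism from `(A, mulA)` onto `(B, mulB)`. -/
def IsoOn (mulA : α → α → α) (mulB : β → β → β) (A : Set α) (B : Set β) : Prop :=
  ∃ θ : α → β, Set.BijOn θ A B ∧ ∀ a ∈ A, ∀ b ∈ A, θ (mulA a b) = mulB (θ a) (θ b)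

/-- `S0` is an adequate transversal of the abundant semigroup `U`.  `S0` is an
adequate `*`-subsemigroup of `U` (witnessed by `plus`/`star`, the canonical
idempotents `a⁺ ℛ* a`, `a⋆ ℒ* a` of elements of `S0`, the `ℛ*`/`ℒ*` relations
being those of the big semigroup `U`, which gives the `*`-subsemigroup property),
and every `x ∈ U` factors uniquely as `x = e_x x̄ f_x` with `x̄ ∈ S0`,
`e_x, f_x` idempotents of `U`, `e_x ℒ x̄⁺` and `f_x ℛ x̄⋆`. -/
structure AdequateTransversalOn (mul : α → α → α) (U S0 : Set α) where
  sub : S0 ⊆ U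
  mul_mem : ∀ a ∈ S0, ∀ b ∈ S0, mul a b ∈ S0
  bar : α → α
  e : α → α
  f : α → α
  plus : α → α
  star : α → α
  plus_mem : ∀ a ∈ S0, plus a ∈ S0
  plus_idem : ∀ a ∈ S0, Idem mul (plus a)
  plus_rstar : ∀ a ∈ S0, RStarOn mul U a (plus a)
  star_mem : ∀ a ∈ S0, star a ∈ S0
  star_idem : ∀ a ∈ S0, Idem mul (star a)
  star_lstar : ∀ a ∈ S0, LStarOn mul U a (star a)
  idem_comm : ∀ u ∈ S0, ∀ v ∈ S0, Idem mul u → Idem mul v → mul u v = mul v u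
  bar_mem : ∀ x ∈ U, bar x ∈ S0
  e_mem : ∀ x ∈ U, e x ∈ U
  f_mem : ∀ x ∈ U, f x ∈ U
  e_idem : ∀ x ∈ U, Idem mul (e x)
  f_idem : ∀ x ∈ U, Idem mul (f x)
  decomp : ∀ x ∈ U, x = mul (mul (e x) (bar x)) (f x)
  e_greenL : ∀ x ∈ U, GreenLOn mul U (e x) (plus (bar x))
  f_greenR : ∀ x ∈ U, GreenROn mul U (f x) (star (bar x))
  unique : ∀ x ∈ U, ∀ s ∈ S0, ∀ e' ∈ U, ∀ f' ∈ U, Idem mul e' → Idem mul f' →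
      x = mul (mul e' s) f' → GreenLOn mul U e' (plus s) → GreenROn mul U f' (star s) →
      s = bar x ∧ e' = e x ∧ f' = f x

namespace AdequateTransversalOn

variable {mul : α → α → α} {U S0 : Set α}

/-- `R = {x ∈ U : e_x = e_{x̄}}`. -/
def Rset (T : AdequateTransversalOn mul U S0) : Set α :=
  {x | x ∈ U ∧ T.e x = T.e (T.bar x)}

/-- `L = {x ∈ U : f_x = f_{x̄}}`. -/
def Lset (T : AdequateTransversalOn mul U S0) : Set α :=
  {x | x ∈ U ∧ T.f x = T.f (T.bar x)}

/-- `I = {e_x : x ∈ U}`. -/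
def Iset (T : AdequateTransversalOn mul U S0) : Set α :=
  {y | ∃ x ∈ U, T.e x = y}

/-- `Λ = {f_x : x ∈ U}`. -/
def LamSet (T : AdequateTransversalOn mul U S0) : Set α :=
  {y | ∃ x ∈ U, T.f x = y}

/-- The transversal is multiplicative: `Λ I ⊆ E⁰`. -/
def IsMultiplicative (T : AdequateTransversalOn mul U S0) : Prop :=
  ∀ l ∈ T.LamSet, ∀ i ∈ T.Iset, mul l i ∈ S0 ∧ Idem mul (mul l i)

end AdequateTransversalOn

/-- The spined product set `T = L |×| R ⊆ S × S` attached to an adequate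
transversal of `S` (ambient carrier `U`). -/
def spSet {mul : α → α → α} {U S0 : Set α}
    (T : AdequateTransversalOn mul U S0) : Set (α × α) :=
  {p | p.1 ∈ T.Lset ∧ p.2 ∈ T.Rset ∧ T.bar p.1 = T.bar p.2}

/-- The multiplication `(x,a)(y,b) = (e_x(ay), (ay) f_b)` on the spined product. -/
def spMul {mul : α → α → α} {U S0 : Set α}
    (T : AdequateTransversalOn mul U S0) : α × α → α × α → α × α :=
  fun p q => (mul (T.e p.1) (mul p.2 q.1), mul (mul p.2 q.1) (T.f q.2))

/-- The map `φ : S → T`, `x ↦ (e_x x̄, x̄ f_x)`. -/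
def phiMap {mul : α → α → α} {U S0 : Set α}
    (T : AdequateTransversalOn mul U S0) : α → α × α :=
  fun x => (mul (T.e x) (T.bar x), mul (T.bar x) (T.f x))

/-- `T⁰ = {(s,s) : s ∈ S0}`. -/
def diagSet (S0 : Set α) : Set (α × α) := {p | ∃ s ∈ S0, p = (s, s)}

/-- Abstract spined product `L |×| R` over a common transversal `S⁰` (a type `γ`
embedded into `L` and `R` by `jL`, `jR`). -/
def absTset {mulL : α → α → α} {mulR : β → β → β} {jL : γ → α} {jR : γ → β}
    (TL : AdequateTransversalOn mulL Set.univ (Set.range jL))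
    (TR : AdequateTransversalOn mulR Set.univ (Set.range jR)) : Set (α × β) :=
  {p | ∃ s : γ, jL s = TL.bar p.1 ∧ jR s = TR.bar p.2}

/-- The multiplication `(x,a)(y,b) = (e_x(a∗y), (a∗y) f_b)`. -/
def absMul {mulL : α → α → α} {mulR : β → β → β} {jL : γ → α} {jR : γ → β}
    (TL : AdequateTransversalOn mulL Set.univ (Set.range jL))
    (TR : AdequateTransversalOn mulR Set.univ (Set.range jR))
    (st : β → α → γ) : α × β → α × β → α × β :=
  fun p q => (mulL (TL.e p.1) (jL (st p.2 q.1)), mulR (jR (st p.2 q.1)) (TR.f q.2))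

/-- `T⁰ = {(s,s) : s ∈ S⁰}` inside `L × R`, where `s` is viewed in `L` and in `R`. -/
def absT0 (jL : γ → α) (jR : γ → β) : Set (α × β) :=
  {p | ∃ s : γ, p = (jL s, jR s)}

/-- `S0` is an inverse transversal of the regular semigroup `U`: an inverse
subsemigroup meeting the set of inverses of each `x ∈ U` in exactly one
element `o x = x⁰`. -/
structure InverseTransversalOn (mul : α → α → α) (U S0 : Set α) where
  sub : S0 ⊆ U
  mul_mem : ∀ a ∈ S0, ∀ b ∈ S0, mul a b ∈ S0
  o : α → α
  o_mem : ∀ x ∈ U, o x ∈ S0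
  o_inv1 : ∀ x ∈ U, mul (mul x (o x)) x = x
  o_inv2 : ∀ x ∈ U, mul (mul (o x) x) (o x) = o x
  o_unique : ∀ x ∈ U, ∀ u ∈ S0, mul (mul x u) x = x → mul (mul u x) u = u → u = o x
  idem_comm : ∀ u ∈ S0, ∀ v ∈ S0, Idem mul u → Idem mul v → mul u v = mul v u

namespace InverseTransversalOn

variable {mul : α → α → α} {U S0 : Set α}

/-- `L = {x ∈ U : x⁰x ∈ E⁰}`. -/
def LsetI (T : InverseTransversalOn mul U S0) : Set α :=
  {x | x ∈ U ∧ mul (T.o x) x ∈ S0 ∧ Idem mul (mul (T.o x) x)}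

/-- `R = {x ∈ U : xx⁰ ∈ E⁰}`. -/
def RsetI (T : InverseTransversalOn mul U S0) : Set α :=
  {x | x ∈ U ∧ mul x (T.o x) ∈ S0 ∧ Idem mul (mul x (T.o x))}

end InverseTransversalOn

/-- Spined product set for an inverse transversal: `{(x,a) : x⁰ = a⁰}`. -/
def invSpSet {mul : α → α → α} {U S0 : Set α}
    (T : InverseTransversalOn mul U S0) : Set (α × α) :=
  {p | p.1 ∈ T.LsetI ∧ p.2 ∈ T.RsetI ∧ T.o p.1 = T.o p.2}

/-- The multiplication `(x,a)(y,b) = ((xx⁰)(ay), (ay)(b⁰b))`. -/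
def invSpMul {mul : α → α → α} {U S0 : Set α}
    (T : InverseTransversalOn mul U S0) : α × α → α × α → α × α :=
  fun p q => (mul (mul p.1 (T.o p.1)) (mul p.2 q.1),
              mul (mul p.2 q.1) (mul (T.o q.2) q.2))

/-- Abstract spined product for inverse transversals: `{(x,a) : x⁰ = a⁰}`. -/
def invAbsTset {mulL : α → α → α} {mulR : β → β → β} {jL : γ → α} {jR : γ → β}
    (TL : InverseTransversalOn mulL Set.univ (Set.range jL))
    (TR : InverseTransversalOn mulR Set.univ (Set.range jR)) : Set (α × β) :=
  {p | ∃ s : γ, jL s = TL.o p.1 ∧ jR s = TR.o p.2}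

/-- The multiplication `(x,a)(y,b) = ((xx⁰)(a∗y), (a∗y)(b⁰b))`. -/
def invAbsMul {mulL : α → α → α} {mulR : β → β → β} {jL : γ → α} {jR : γ → β}
    (TL : InverseTransversalOn mulL Set.univ (Set.range jL))
    (TR : InverseTransversalOn mulR Set.univ (Set.range jR))
    (st : β → α → γ) : α × β → α × β → α × β :=
  fun p q => (mulL (mulL p.1 (TL.o p.1)) (jL (st p.2 q.1)),
              mulR (jR (st p.2 q.1)) (mulR (TR.o q.2) q.2))

/-- The multiplication `(e,x)(g,w) = (e(aa⁻¹), a)`, `a = x((x⁻¹x)g)w`, on `I × S⁰`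
(Chen-style construction from a left normal band `I` with semilattice transversal
`E⁰ = E(S⁰)`; `σ` embeds idempotents of the inverse semigroup `γ` into the band
`β`, and `π : β → γ` is the semilattice-transversal map `e ↦ e⁰`). -/
def bandMul (mulB : β → β → β) (mulG : γ → γ → γ) (σ : γ → β) (π : β → γ)
    (inv : γ → γ) (p q : β × γ) : β × γ :=
  let a := mulG (mulG p.2 (π (mulB (σ (mulG (inv p.2) p.2)) q.1))) q.2
  (mulB p.1 (σ (mulG a (inv a))), a)

/-- `T = {(e,x) : e⁰ = xx⁻¹}`. -/
def bandTset (mulG : γ → γ → γ) (π : β → γ) (inv : γ → γ) : Set (β × γ) :=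
  {p | π p.1 = mulG p.2 (inv p.2)}

/-- `T⁰ = {(aa⁻¹, a) : a ∈ S⁰}` (with `aa⁻¹` viewed in the band via `σ`). -/
def bandT0 (mulG : γ → γ → γ) (σ : γ → β) (inv : γ → γ) : Set (β × γ) :=
  {p | ∃ s : γ, p = (σ (mulG s (inv s)), s)}

end Paper

namespace Paper

section Semigroup

variable {S : Type*} [Semigroup S] {S0 : Set S}

theorem GreenLOn.mul_eq {u v : S} (h : GreenLOn (mulOf S) Set.univ u v)
    (hu : u * u = u) (hv : v * v = v) : u * v = u ∧ v * u = v := by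
  obtain ⟨h1, h2⟩ := h
  constructor
  · rcases h1 with rfl | ⟨w, -, rfl⟩
    · exact hu
    · change w * v * v = w * v
      rw [mul_assoc, hv]
  · rcases h2 with rfl | ⟨w, -, rfl⟩
    · exact hv
    · change w * u * u = w * u
      rw [mul_assoc, hu]

theorem GreenROn.mul_eq {u v : S} (h : GreenROn (mulOf S) Set.univ u v)
    (hu : u * u = u) (hv : v * v = v) : u * v = v ∧ v * u = u := by
  obtain ⟨h1, h2⟩ := h
  constructor
  · rcases h2 with rfl | ⟨w, -, rfl⟩
    · exact hv
    · change u * (u * w) = u * w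
      rw [← mul_assoc, hu]
  · rcases h1 with rfl | ⟨w, -, rfl⟩
    · exact hu
    · change v * (v * w) = v * w
      rw [← mul_assoc, hv]

theorem GreenLOn.of_mul_eq {u v : S} (h1 : u * v = u) (h2 : v * u = v) :
    GreenLOn (mulOf S) Set.univ u v :=
  ⟨.inr ⟨u, trivial, h1⟩, .inr ⟨v, trivial, h2⟩⟩

theorem GreenROn.of_mul_eq {u v : S} (h1 : u * v = v) (h2 : v * u = u) :
    GreenROn (mulOf S) Set.univ u v :=
  ⟨.inr ⟨u, trivial, h2⟩, .inr ⟨v, trivial, h1⟩⟩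

theorem RStarOn.of_mul_eq {u v : S} (h1 : u * v = v) (h2 : v * u = u) :
    RStarOn (mulOf S) Set.univ u v := by
  have key : ∀ {u v : S}, u * v = v → ∀ x y : S, x * u = y * u → x * v = y * v := by
    intro u v h x y hxy
    rw [← h, ← mul_assoc, ← mul_assoc, hxy]
  have key' : ∀ {u v : S}, u * v = v → ∀ x : S, x * u = u → x * v = v := by
    intro u v h x hx
    rw [← h, ← mul_assoc, hx]
  exact ⟨fun x _ y _ => ⟨key h1 x y, key h2 x y⟩, fun x _ => ⟨key' h1 x, key' h2 x⟩⟩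

theorem LStarOn.of_mul_eq {u v : S} (h1 : u * v = u) (h2 : v * u = v) :
    LStarOn (mulOf S) Set.univ u v := by
  have key : ∀ {u v : S}, v * u = v → ∀ x y : S, u * x = u * y → v * x = v * y := by
    intro u v h x y hxy
    rw [← h, mul_assoc, mul_assoc, hxy]
  have key' : ∀ {u v : S}, v * u = v → ∀ x : S, u * x = u → v * x = v := by
    intro u v h x hx
    rw [← h, mul_assoc, hx]
  exact ⟨fun x _ y _ => ⟨key h2 x y, key h1 x y⟩, fun x _ => ⟨key' h2 x, key' h1 x⟩⟩

namespace AdequateTransversalOn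

variable (T : AdequateTransversalOn (mulOf S) Set.univ S0)

theorem plus_mul_plus {c : S} (hc : c ∈ S0) : T.plus c * T.plus c = T.plus c :=
  T.plus_idem c hc

theorem star_mul_star {c : S} (hc : c ∈ S0) : T.star c * T.star c = T.star c :=
  T.star_idem c hc

theorem plus_mul_self {c : S} (hc : c ∈ S0) : T.plus c * c = c :=
  ((T.plus_rstar c hc).2 _ trivial).2 (T.plus_idem c hc)

theorem self_mul_star {c : S} (hc : c ∈ S0) : c * T.star c = c :=
  ((T.star_lstar c hc).2 _ trivial).2 (T.star_idem c hc)

theorem components_of_mem {c : S} (hc : c ∈ S0) :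
    c = T.bar c ∧ T.plus c = T.e c ∧ T.star c = T.f c := by
  refine T.unique c trivial c hc _ trivial _ trivial (T.plus_idem c hc) (T.star_idem c hc) ?_
    ⟨.inl rfl, .inl rfl⟩ ⟨.inl rfl, .inl rfl⟩
  change c = T.plus c * c * T.star c
  rw [T.plus_mul_self hc, T.self_mul_star hc]

theorem e_mul_right {c g f : S} (hc : c ∈ S0) (hg : g ∈ S0) (hgg : g * g = g) (hff : f * f = f)
    (hfg : GreenROn (mulOf S) Set.univ f g) (hcg : c * g = c) : T.e c = T.e (c * f) := by
  obtain ⟨h1, h2⟩ := hfg.mul_eq hff hgg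
  have hss := T.star_mul_star hc
  have hcs := T.self_mul_star hc
  have hsg : T.star c * g = T.star c := ((T.star_lstar c hc).2 g trivial).1 hcg
  have hgs : g * T.star c = T.star c :=
    (T.idem_comm g hg _ (T.star_mem c hc) hgg (T.star_idem c hc)).trans hsg
  have hfs : f * T.star c = T.star c := by
    rw [← hgs, ← mul_assoc, h1]
  have h3 : T.star c * f * T.star c = T.star c := by
    rw [mul_assoc, hfs, hss]
  have h4 : T.star c * (T.star c * f) = T.star c * f := by rw [← mul_assoc, hss]
  have hid : T.star c * f * (T.star c * f) = T.star c * f := by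
    rw [← mul_assoc, h3]
  have hdec : c * f = T.plus c * c * (T.star c * f) := by
    rw [T.plus_mul_self hc, ← mul_assoc, hcs]
  have := T.unique (c * f) trivial c hc (T.plus c) trivial (T.star c * f) trivial
    (T.plus_idem c hc) hid hdec ⟨.inl rfl, .inl rfl⟩ (GreenROn.of_mul_eq h3 h4)
  rw [← this.2.1, (T.components_of_mem hc).2.1]

theorem f_mul_left {c g e : S} (hc : c ∈ S0) (hg : g ∈ S0) (hgg : g * g = g) (hee : e * e = e)
    (heg : GreenLOn (mulOf S) Set.univ e g) (hgc : g * c = c) : T.f (e * c) = T.f c := by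
  obtain ⟨h1, h2⟩ := heg.mul_eq hee hgg
  have hpp := T.plus_mul_plus hc
  have hpc := T.plus_mul_self hc
  have hgp : g * T.plus c = T.plus c := ((T.plus_rstar c hc).2 g trivial).1 hgc
  have hpg : T.plus c * g = T.plus c :=
    (T.idem_comm _ (T.plus_mem c hc) g hg (T.plus_idem c hc) hgg).trans hgp
  have hpe : T.plus c * e = T.plus c := by
    rw [← hpg, mul_assoc, h2]
  have h3 : T.plus c * (e * T.plus c) = T.plus c := by
    rw [← mul_assoc, hpe, hpp]
  have h4 : e * T.plus c * T.plus c = e * T.plus c := by rw [mul_assoc, hpp]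
  have hid : e * T.plus c * (e * T.plus c) = e * T.plus c := by
    rw [mul_assoc, h3]
  have hdec : e * c = e * T.plus c * c * T.star c := by
    rw [mul_assoc e, hpc, mul_assoc, T.self_mul_star hc]
  have := T.unique (e * c) trivial c hc (e * T.plus c) trivial (T.star c) trivial
    hid (T.star_idem c hc) hdec (GreenLOn.of_mul_eq h4 h3) ⟨.inl rfl, .inl rfl⟩
  rw [← this.2.2, (T.components_of_mem hc).2.2]

theorem e_mul_bar (hS : LeftAdequateOn (mulOf S) Set.univ) (x : S) : T.e x * T.bar x = x := by
  have hb := T.bar_mem x trivial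
  obtain ⟨h1, h2⟩ := (T.f_greenR x trivial).mul_eq (T.f_idem x trivial) (T.star_idem _ hb)
  have hf : T.f x = T.star (T.bar x) := hS.2 _ trivial _ trivial (T.f_idem x trivial)
    (T.star_idem _ hb) (RStarOn.of_mul_eq h1 h2)
  have hd : x = T.e x * T.bar x * T.f x := T.decomp x trivial
  rw [hf, mul_assoc, T.self_mul_star hb] at hd
  exact hd.symm

theorem bar_mul_f (hS : RightAdequateOn (mulOf S) Set.univ) (x : S) : T.bar x * T.f x = x := by
  have hb := T.bar_mem x trivial
  obtain ⟨h1, h2⟩ := (T.e_greenL x trivial).mul_eq (T.e_idem x trivial) (T.plus_idem _ hb)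
  have he : T.e x = T.plus (T.bar x) := hS.2 _ trivial _ trivial (T.e_idem x trivial)
    (T.plus_idem _ hb) (LStarOn.of_mul_eq h1 h2)
  have hd : x = T.e x * T.bar x * T.f x := T.decomp x trivial
  rw [he, T.plus_mul_self hb] at hd
  exact hd.symm

end AdequateTransversalOn

end Semigroup

end Paper

open Paper in
/-- **Lemma `e-f-lemma`.** If `a, b ∈ R`, `y, z ∈ L` with
`ȳ = b̄`, then `e_{a∗y} = e_{(a∗y)f_b}` and `f_{e_y(b∗z)} = f_{b∗z}`. -/
theorem stmt11 {L R G : Type u} [Semigroup L] [Semigroup R] [Semigroup G]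
    (jL : G → L) (jR : G → R)
    (hjL : Function.Injective jL) (hjR : Function.Injective jR)
    (hjLm : ∀ s t : G, jL (s * t) = jL s * jL t)
    (hjRm : ∀ s t : G, jR (s * t) = jR s * jR t)
    (hG : AdequateOn (mulOf G) Set.univ)
    (hL : LeftAdequateOn (mulOf L) Set.univ)
    (hR : RightAdequateOn (mulOf R) Set.univ)
    (TL : AdequateTransversalOn (mulOf L) Set.univ (Set.range jL))
    (TR : AdequateTransversalOn (mulOf R) Set.univ (Set.range jR))
    (hQL : QuasiIdealOn (mulOf L) Set.univ (Set.range jL))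
    (hQR : QuasiIdealOn (mulOf R) Set.univ (Set.range jR))
    (st : R → L → G)
    (cond1 : ∀ (y z : L) (a b : R),
      (∃ s : G, jL s = TL.bar y ∧ jR s = TR.bar b) →
      st (jR (st a y) * TR.f b) z = st a (TL.e y * jL (st b z)))
    (cond2L : ∀ (s : G) (x : L), jL (st (jR s) x) = jL s * x)
    (cond2R : ∀ (a : R) (s : G), jR (st a (jL s)) = a * jR s)
    :
    ∀ (a b : R) (y z : L),
      (∃ s : G, jL s = TL.bar y ∧ jR s = TR.bar b) →
      TR.e (jR (st a y)) = TR.e (jR (st a y) * TR.f b) ∧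
      TL.f (TL.e y * jL (st b z)) = TL.f (jL (st b z)) := by
  rintro a b y z ⟨s, hsL, hsR⟩
  have hmL : ∀ t, jL t ∈ Set.range jL := fun t => ⟨t, rfl⟩
  have hmR : ∀ t, jR t ∈ Set.range jR := fun t => ⟨t, rfl⟩
  constructor
  · obtain ⟨g, hg⟩ := TR.star_mem (jR s) (hmR s)
    have hgg : jR g * jR g = jR g := by
      rw [hg]; exact TR.star_mul_star (hmR s)
    have hsg : s * g = s := hjR (by rw [hjRm, hg, TR.self_mul_star (hmR s)])
    obtain ⟨hbar, -, hf⟩ := TR.components_of_mem (hmR s)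
    have hz : st (jR s) (jL g) = s := hjL (by rw [cond2L, ← hjLm, hsg])
    have h := cond1 y (jL g) a (jR s) ⟨s, hsL, hbar⟩
    rw [← hf, ← hg, hz, hsL, TL.e_mul_bar hL] at h
    have hcg : jR (st a y) * jR g = jR (st a y) := by
      have h' := congrArg jR h
      rwa [cond2R, mul_assoc, hgg] at h'
    refine TR.e_mul_right (hmR _) (hmR g) hgg (TR.f_idem b trivial) ?_ hcg
    rw [hg, hsR]
    exact TR.f_greenR b trivial
  · obtain ⟨g, hg⟩ := TL.plus_mem (jL s) (hmL s)
    have hgg : jL g * jL g = jL g := by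
      rw [hg]; exact TL.plus_mul_plus (hmL s)
    have hgs : g * s = s := hjL (by rw [hjLm, hg, TL.plus_mul_self (hmL s)])
    obtain ⟨hbar, he, -⟩ := TL.components_of_mem (hmL s)
    have ha : st (jR g) (jL s) = s := hjR (by rw [cond2R, ← hjRm, hgs])
    have h := cond1 (jL s) z (jR g) b ⟨s, hbar, hsR⟩
    rw [← he, ← hg, ha, hsR, TR.bar_mul_f hR] at h
    have hgc : jL g * jL (st b z) = jL (st b z) := by
      have h' := congrArg jL h
      rw [cond2L, ← mul_assoc, hgg] at h'
      exact h'.symm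
    refine TL.f_mul_left (hmL _) (hmL g) hgg (TL.e_idem y trivial) ?_ hgc
    rw [hg, hsL]
    exact TL.e_greenL y trivial
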